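/- There is no finite group of order 7200 (= 80·90 = 2⁵·3²·5²) that has an irreducible complex character of degree 80. -/

import Mathlib

open CategoryTheory

/-- `χ : G → ℂ` is the character of an irreducible (simple) finite-dimensional complex
representation of the group `G`. -/
def IsIrrChar (G : Type) [Group G] (χ : G → ℂ) : Prop :=
  ∃ V : FDRep ℂ G, Simple V ∧ FDRep.character V = χ

open Module

/-- An endomorphism of finite order `n` is diagonalizable, with `n`-th roots of unity as
eigenvalues. -/
theorem exists_eigenvalues_of_pow_eq_one {M : Type*} [AddCommGroup M] [Module ℂ M]
    [FiniteDimensional ℂ M] (f : Module.End ℂ M) {n : ℕ} (hn : n ≠ 0) (hf : f ^ n = 1) :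
    ∃ (I : Type) (_ : Fintype I) (μ : I → ℂ), (∀ i, μ i ^ n = 1) ∧
      ∀ k : ℕ, LinearMap.trace ℂ M (f ^ k) = ∑ i, μ i ^ k := by
  classical
  have hss : f.IsSemisimple := by
    refine Module.End.isSemisimple_of_squarefree_aeval_eq_zero
      (p := Polynomial.X ^ n - 1) ?_ (by simp [hf])
    have : (n : ℂ) ≠ 0 := by exact_mod_cast hn
    exact ((Polynomial.X_pow_sub_one_separable_iff (F := ℂ)).2 this).squarefree
  have hint : DirectSum.IsInternal (fun μ : ℂ ↦ f.eigenspace μ) :=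
    DirectSum.isInternal_submodule_of_iSupIndep_of_iSup_eq_top
      f.eigenspaces_iSupIndep hss.iSup_eigenspace_eq_top
  let I := (ν : ℂ) × Fin (finrank ℂ (f.eigenspace ν))
  let v : Basis I ℂ M := hint.collectedBasis fun μ ↦ finBasis ℂ (f.eigenspace μ)
  let _ : Fintype I := FiniteDimensional.fintypeBasisIndex v
  have hv (i : I) : f (v i) = i.1 • v i :=
    Module.End.mem_eigenspace_iff.mp (hint.collectedBasis_mem _ i)
  have hvk (k : ℕ) (i : I) : (f ^ k) (v i) = i.1 ^ k • v i := by
    induction k with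
    | zero => simp
    | succ k ih => rw [pow_succ', Module.End.mul_apply, ih, map_smul, hv, smul_smul, pow_succ]
  refine ⟨I, inferInstance, Sigma.fst, fun i ↦ ?_, fun k ↦ ?_⟩
  · have h := hvk n i
    rw [hf, Module.End.one_apply] at h
    have h2 : (i.1 ^ n - 1) • v i = 0 := by rw [sub_smul, ← h, one_smul, sub_self]
    exact sub_eq_zero.1 ((smul_eq_zero.1 h2).resolve_right (v.ne_zero i))
  · rw [LinearMap.trace_eq_matrix_trace ℂ v, Matrix.trace]
    simp [LinearMap.toMatrix_apply, hvk]

namespace FDRep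

variable {G : Type} [Group G] (V : FDRep ℂ G)

/-- The eigenvalues of a group element, counted with multiplicity. -/
theorem exists_eigenvalues [Finite G] (g : G) :
    ∃ (I : Type) (_ : Fintype I) (μ : I → ℂ), (∀ i, μ i ^ Nat.card G = 1) ∧
      ∀ k : ℕ, V.character (g ^ k) = ∑ i, μ i ^ k := by
  obtain ⟨I, hI, μ, h1, h2⟩ := exists_eigenvalues_of_pow_eq_one (V.ρ g) (n := Nat.card G)
    Nat.card_pos.ne' (by rw [← map_pow, pow_card_eq_one', map_one])
  exact ⟨I, hI, μ, h1, fun k ↦ by rw [← h2, ← map_pow]; rfl⟩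

theorem character_inv_eq_conj [Finite G] (g : G) :
    V.character g⁻¹ = starRingEnd ℂ (V.character g) := by
  obtain ⟨I, hI, μ, h1, h2⟩ := V.exists_eigenvalues g
  have hG : Nat.card G ≠ 0 := Nat.card_pos.ne'
  have hinv : g⁻¹ = g ^ (Nat.card G - 1) := by
    rw [inv_eq_iff_mul_eq_one, ← pow_succ', Nat.sub_add_cancel Nat.card_pos, pow_card_eq_one']
  have h3 := h2 1
  rw [pow_one] at h3
  rw [hinv, h2, h3, map_sum]
  refine Finset.sum_congr rfl fun i _ ↦ ?_
  have hnorm : ‖μ i‖ = 1 := Complex.norm_eq_one_of_pow_eq_one (h1 i) hG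
  rw [pow_one, ← Complex.inv_eq_conj hnorm]
  refine eq_inv_of_mul_eq_one_left ?_
  rw [← pow_succ, Nat.sub_add_cancel Nat.card_pos, h1]

theorem isIntegral_character [Finite G] (g : G) : IsIntegral ℤ (V.character g) := by
  obtain ⟨I, hI, μ, h1, h2⟩ := V.exists_eigenvalues g
  rw [← pow_one g, h2]
  refine IsIntegral.sum _ fun i _ ↦ ?_
  rw [pow_one]
  exact IsIntegral.of_pow Nat.card_pos (by rw [h1]; exact isIntegral_one)

end FDRep

theorem exists_isIntegral_sum_pow_prime {I : Type*} (s : Finset I) (μ : I → ℂ) {p : ℕ}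
    (hp : p.Prime) (hμ : ∀ i, IsIntegral ℤ (μ i)) :
    ∃ r : ℂ, IsIntegral ℤ r ∧ (∑ i ∈ s, μ i) ^ p = ∑ i ∈ s, μ i ^ p + p * r := by
  classical
  let ν (i : I) : integralClosure ℤ ℂ := ⟨μ i, hμ i⟩
  have key : ∃ r : integralClosure ℤ ℂ, (∑ i ∈ s, ν i) ^ p = ∑ i ∈ s, ν i ^ p + p * r := by
    induction s using Finset.induction_on with
    | empty => exact ⟨0, by simp [hp.ne_zero]⟩
    | insert a s ha ih =>
      obtain ⟨r, hr⟩ := ih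
      obtain ⟨t, ht⟩ := exists_add_pow_prime_eq hp (ν a) (∑ i ∈ s, ν i)
      refine ⟨r + ν a * (∑ i ∈ s, ν i) * t, ?_⟩
      rw [Finset.sum_insert ha, Finset.sum_insert ha, ht, hr]
      ring
  obtain ⟨r, hr⟩ := key
  refine ⟨r, r.2, ?_⟩
  have := congrArg (algebraMap (integralClosure ℤ ℂ) ℂ) hr
  simpa [ν] using this

/-- A rational algebraic integer is an integer. -/
theorem exists_int_of_isIntegral_of_eq_ratCast {a : ℂ} (ha : IsIntegral ℤ a) {q : ℚ}
    (hq : a = q) : ∃ n : ℤ, a = n := by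
  have : IsIntegral ℤ q := by
    rw [hq] at ha
    exact (isIntegral_algebraMap_iff (R := ℤ) (algebraMap ℚ ℂ).injective).1 ha
  obtain ⟨n, hn⟩ := IsIntegrallyClosed.isIntegral_iff.1 this
  exact ⟨n, by rw [hq, ← hn]; simp⟩

namespace FDRep

variable {G : Type} [Group G] (V : FDRep ℂ G)

/-- Integer valued characters satisfy `χ (g ^ p) ≡ χ g` modulo `p`. -/
theorem int_character_pow_prime_modEq [Finite G] {c : G → ℤ} (hc : ∀ g, V.character g = c g)
    {p : ℕ} (hp : p.Prime) (g : G) : c (g ^ p) ≡ c g [ZMOD p] := by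
  obtain ⟨I, hI, μ, h1, h2⟩ := V.exists_eigenvalues g
  obtain ⟨r, hr, h⟩ := exists_isIntegral_sum_pow_prime Finset.univ μ hp fun i ↦
    IsIntegral.of_pow (Nat.card_pos (α := G)) (by rw [h1]; exact isIntegral_one)
  have e1 := h2 1
  simp only [pow_one] at e1
  rw [← e1, ← h2, hc, hc] at h
  have hp0 : (p : ℂ) ≠ 0 := by exact_mod_cast hp.ne_zero
  obtain ⟨n, rfl⟩ := exists_int_of_isIntegral_of_eq_ratCast hr
    (q := ((c g ^ p - c (g ^ p) : ℤ) : ℚ) / p) (by push_cast; field_simp; rw [h]; ring)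
  have h' : c g ^ p = c (g ^ p) + p * n := by exact_mod_cast h
  have : Fact p.Prime := ⟨hp⟩
  have fermat : c g ^ p ≡ c g [ZMOD p] := by
    rw [← ZMod.intCast_eq_intCast_iff]; push_cast; exact ZMod.pow_card _
  refine Int.ModEq.trans ?_ fermat
  rw [h']
  exact Int.modEq_iff_dvd.2 ⟨n, by ring⟩

theorem int_character_pow_prime_pow_modEq [Finite G] {c : G → ℤ} (hc : ∀ g, V.character g = c g)
    {p : ℕ} (hp : p.Prime) (g : G) (k : ℕ) : c (g ^ p ^ k) ≡ c g [ZMOD p] := by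
  induction k with
  | zero => simp
  | succ k ih =>
    rw [pow_succ, pow_mul]
    exact (V.int_character_pow_prime_modEq hc hp _).trans ih

end FDRep

/-- Conjugate algebraic numbers are related by an automorphism of `ℂ`. -/
theorem exists_ringEquiv_complex_of_isConjRoot {a b : ℂ} (ha : IsAlgebraic ℚ a)
    (hab : IsConjRoot ℚ a b) : ∃ σ : ℂ ≃+* ℂ, σ a = b := by
  let A := algebraicClosure ℚ ℂ
  have hA := algebraicClosure.isAlgClosure ℚ ℂ
  have hN := @IsAlgClosure.normal _ _ _ _ _ hA
  have hb : IsAlgebraic ℚ b := (hab.isIntegral ha.isIntegral).isAlgebraic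
  let a' : A := ⟨a, mem_algebraicClosure_iff.2 ha⟩
  let b' : A := ⟨b, mem_algebraicClosure_iff.2 hb⟩
  have hab' := (isConjRoot_algHom_iff (x := b') (y := a') A.val).1 hab.symm
  obtain ⟨τ, hτ⟩ := IsConjRoot.exists_algEquiv hab'
  obtain ⟨s, hs⟩ := exists_isTranscendenceBasis A ℂ
  have : IsAlgClosure (Algebra.adjoin A (Set.range ((↑) : s → ℂ))) ℂ :=
    IsAlgClosed.isAlgClosure_of_transcendence_basis _ hs
  let e : Algebra.adjoin A (Set.range ((↑) : s → ℂ)) ≃+*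
      Algebra.adjoin A (Set.range ((↑) : s → ℂ)) :=
    (hs.1.aevalEquiv.symm.toRingEquiv.trans (MvPolynomial.mapEquiv s τ.toRingEquiv)).trans
      hs.1.aevalEquiv.toRingEquiv
  refine ⟨IsAlgClosure.equivOfEquiv ℂ ℂ e, ?_⟩
  have he : e (algebraMap A _ a') = algebraMap A _ b' := by
    have h1 : hs.1.aevalEquiv.symm (algebraMap A _ a') = MvPolynomial.C a' :=
      hs.1.aevalEquiv.symm.commutes a'
    have h2 : hs.1.aevalEquiv (MvPolynomial.C b') = algebraMap A _ b' :=
      hs.1.aevalEquiv.commutes b'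
    change hs.1.aevalEquiv (MvPolynomial.map _ (hs.1.aevalEquiv.symm (algebraMap A _ a'))) = _
    rw [h1, MvPolynomial.map_C, ← h2]
    congr 2
  have h := IsAlgClosure.equivOfEquiv_algebraMap ℂ ℂ e (algebraMap A _ a')
  rw [he] at h
  exact h

/-- An algebraic number fixed by all automorphisms of `ℂ` is rational. -/
theorem exists_rat_of_forall_ringEquiv_eq {a : ℂ} (ha : IsAlgebraic ℚ a)
    (h : ∀ σ : ℂ ≃+* ℂ, σ a = a) : ∃ q : ℚ, a = q := by
  by_contra hq
  have hmem : a ∉ (⊥ : Subalgebra ℚ ℂ) := by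
    rintro ⟨q, hq'⟩
    exact hq ⟨q, hq'.symm⟩
  obtain ⟨b, hb, hab⟩ := (notMem_iff_exists_ne_and_isConjRoot
    (minpoly.irreducible ha.isIntegral).separable (IsAlgClosed.splits _)).1 hmem
  obtain ⟨σ, hσ⟩ := exists_ringEquiv_complex_of_isConjRoot ha hab
  exact hb ((h σ).symm.trans hσ)

namespace FDRep

variable {G : Type} [Group G] (V : FDRep ℂ G)

/-- The representation obtained by applying a ring automorphism of `ℂ` to matrix entries. -/
noncomputable def galoisConj (σ : ℂ ≃+* ℂ) : FDRep ℂ G :=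
  FDRep.of (V := Fin (finrank ℂ V) → ℂ)
    (((Matrix.toLinAlgEquiv' : _ ≃ₐ[ℂ] _).toMonoidHom.comp
      (σ : ℂ →+* ℂ).mapMatrix.toMonoidHom).comp
        ((LinearMap.toMatrixAlgEquiv (finBasis ℂ V)).toMonoidHom.comp V.ρ))

theorem character_galoisConj (σ : ℂ ≃+* ℂ) (g : G) :
    (V.galoisConj σ).character g = σ (V.character g) := by
  have h : (V.galoisConj σ).character g = LinearMap.trace ℂ (Fin (finrank ℂ V) → ℂ)
    (Matrix.toLin' ((LinearMap.toMatrix (finBasis ℂ V) (finBasis ℂ V) (V.ρ g)).map σ)) := rfl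
  rw [h, Matrix.trace_toLin'_eq, FDRep.character, LinearMap.trace_eq_matrix_trace ℂ (finBasis ℂ V),
    Matrix.trace, Matrix.trace, map_sum]
  rfl

theorem simple_galoisConj [Finite G] [Simple V] (σ : ℂ ≃+* ℂ) : Simple (V.galoisConj σ) := by
  have := Fintype.ofFinite G
  rw [simple_iff_char_is_norm_one]
  have h := (simple_iff_char_is_norm_one V).1 inferInstance
  simp only [character_galoisConj, ← map_mul]
  rw [← map_sum, h, map_natCast]

theorem sum_character_mul_inv_eq_zero (W : FDRep ℂ G) [Fintype G] [Simple V] [Simple W]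
    (h : V.character ≠ W.character) : ∑ g : G, V.character g * W.character g⁻¹ = 0 := by
  classical
  have hG : (Nat.card G : ℂ) ≠ 0 := by exact_mod_cast Nat.card_pos.ne'
  have := invertibleOfNonzero hG
  have h1 := char_orthonormal V W
  rw [if_neg fun ⟨i⟩ ↦ h (char_iso i)] at h1
  exact (mul_eq_zero.1 h1).resolve_left (inv_ne_zero hG)

/-- Bessel's inequality for the delta function at `1` and two distinct irreducible characters. -/
theorem sq_finrank_add_sq_finrank_le_card (W : FDRep ℂ G) [Finite G] [Simple V] [Simple W]
    (h : V.character ≠ W.character) : finrank ℂ V ^ 2 + finrank ℂ W ^ 2 ≤ Nat.card G := by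
  classical
  have := Fintype.ofFinite G
  set N := Nat.card G with hN
  set d := finrank ℂ V
  set e := finrank ℂ W
  have hVV := (simple_iff_char_is_norm_one V).1 inferInstance
  have hWW := (simple_iff_char_is_norm_one W).1 inferInstance
  have hVW := sum_character_mul_inv_eq_zero V W h
  have hWV := sum_character_mul_inv_eq_zero W V h.symm
  have hV1 : V.character 1 = d := char_one V
  have hW1 : W.character 1 = e := char_one W
  let f (g : G) : ℂ := (if g = 1 then (N : ℂ) else 0) - (d * V.character g + e * W.character g)
  have hf (g : G) : starRingEnd ℂ (f g) =
      (if g = 1 then (N : ℂ) else 0) - (d * V.character g⁻¹ + e * W.character g⁻¹) := by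
    simp only [f, map_sub, map_add, map_mul, map_natCast, character_inv_eq_conj]
    split_ifs <;> simp
  have hsum : ∑ g, f g * starRingEnd ℂ (f g) = N * (N - (d ^ 2 + e ^ 2)) := by
    have expand (g : G) : f g * starRingEnd ℂ (f g) =
        (if g = 1 then (N : ℂ) * (N - 2 * (d ^ 2 + e ^ 2)) else 0) +
        (d ^ 2 * (V.character g * V.character g⁻¹) + d * e * (V.character g * W.character g⁻¹)
          + d * e * (W.character g * V.character g⁻¹)
          + e ^ 2 * (W.character g * W.character g⁻¹)) := by
      rw [hf]
      by_cases hg : g = 1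
      · subst hg
        simp only [f, inv_one, if_true, hV1, hW1]
        ring
      · simp only [f, if_neg hg]
        ring
    simp only [expand, Finset.sum_add_distrib, ← Finset.mul_sum, hVV, hWW, hVW, hWV,
      Finset.sum_ite_eq', Finset.mem_univ, if_true]
    ring
  have hreal : (∑ g, Complex.normSq (f g) : ℝ) = N * (N - (d ^ 2 + e ^ 2)) := by
    have : ((∑ g, Complex.normSq (f g) : ℝ) : ℂ) = ((N * (N - (d ^ 2 + e ^ 2)) : ℝ) : ℂ) := by
      push_cast
      rw [← hsum]
      simp only [Complex.mul_conj]
    exact_mod_cast this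
  have hnonneg : (0 : ℝ) ≤ N * (N - (d ^ 2 + e ^ 2)) := by
    rw [← hreal]
    exact Finset.sum_nonneg fun g _ ↦ Complex.normSq_nonneg _
  have hNpos : (0 : ℝ) < N := by exact_mod_cast (Nat.card_pos : 0 < Nat.card G)
  have := nonneg_of_mul_nonneg_right hnonneg hNpos
  have hle : (d ^ 2 + e ^ 2 : ℝ) ≤ N := by linarith
  exact_mod_cast hle

/-- An irreducible character whose degree is large compared with `|G|` is integer valued. -/
theorem exists_int_character [Finite G] [Simple V] (hV : Nat.card G < 2 * finrank ℂ V ^ 2) :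
    ∃ c : G → ℤ, ∀ g, V.character g = c g := by
  have key (g : G) : ∃ n : ℤ, V.character g = n := by
    have hint := V.isIntegral_character g
    have halg : IsAlgebraic ℚ (V.character g) := (hint.tower_top (A := ℚ)).isAlgebraic
    obtain ⟨q, hq⟩ := exists_rat_of_forall_ringEquiv_eq halg fun σ ↦ by
      by_contra hne
      have := V.simple_galoisConj σ
      have h : V.character ≠ (V.galoisConj σ).character := fun h ↦
        hne (by rw [← character_galoisConj, ← h])
      have hle := V.sq_finrank_add_sq_finrank_le_card _ h
      have hrank : finrank ℂ (V.galoisConj σ) = finrank ℂ V := by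
        have := (V.galoisConj σ).char_one
        rw [character_galoisConj, char_one, map_natCast] at this
        exact_mod_cast this.symm
      rw [hrank] at hle
      lia
    exact exists_int_of_isIntegral_of_eq_ratCast hint hq
  choose c hc using key
  exact ⟨c, hc⟩

/-- Schur's lemma: an endomorphism commuting with a simple representation is a scalar. -/
theorem exists_eq_smul_of_commute [Simple V] (f : V →ₗ[ℂ] V)
    (hf : ∀ g, f ∘ₗ V.ρ g = V.ρ g ∘ₗ f) : ∃ a : ℂ, f = a • LinearMap.id := by
  let F : V ⟶ V := ⟨FGModuleCat.ofHom f, fun g ↦ by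
    ext x
    exact LinearMap.congr_fun (hf g) x⟩
  obtain ⟨a, ha⟩ := endomorphism_simple_eq_smul_id ℂ F
  refine ⟨a, ?_⟩
  have := congrArg (fun φ : V ⟶ V ↦ φ.hom.hom.hom) ha
  exact this.symm

/-- The central character of an irreducible representation takes algebraic integer values on
class sums. -/
theorem exists_isIntegral_centralCharacter [Fintype G] [Simple V] (g : G) :
    ∃ a : ℂ, IsIntegral ℤ a ∧
      (Nat.card {x // IsConj g x} : ℂ) * V.character g = a * V.character 1 := by
  classical
  let φ : MonoidAlgebra ℤ G →ₐ[ℤ] (V →ₗ[ℂ] V) := MonoidAlgebra.lift ℤ _ _ V.ρ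
  let z : MonoidAlgebra ℤ G := ∑ x with IsConj g x, MonoidAlgebra.of ℤ G x
  have hz : φ z = ∑ x with IsConj g x, V.ρ x := by simp [φ, z]
  obtain ⟨a, ha⟩ := V.exists_eq_smul_of_commute (φ z) fun h ↦ by
    change φ z * V.ρ h = V.ρ h * φ z
    rw [hz, Finset.sum_mul, Finset.mul_sum]
    refine Finset.sum_bij' (fun x _ ↦ h⁻¹ * x * h) (fun x _ ↦ h * x * h⁻¹) ?_ ?_ ?_ ?_ ?_
    · intro x hx
      rw [Finset.mem_filter_univ] at hx ⊢
      exact hx.trans (isConj_iff.2 ⟨h⁻¹, by group⟩)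
    · intro x hx
      rw [Finset.mem_filter_univ] at hx ⊢
      exact hx.trans (isConj_iff.2 ⟨h, rfl⟩)
    · intro x _; group
    · intro x _; group
    · intro x _
      rw [← map_mul, ← map_mul]
      group
  refine ⟨a, ?_, ?_⟩
  · have hzint : IsIntegral ℤ z := IsIntegral.of_finite ℤ z
    have h1 : IsIntegral ℤ (algebraMap ℂ (Module.End ℂ V) a) := by
      have := hzint.map φ
      rwa [ha] at this
    have : Nontrivial V := by
      by_contra hV
      rw [not_nontrivial_iff_subsingleton] at hV
      apply id_nonzero V
      ext x
      exact Subsingleton.elim _ _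
    exact (isIntegral_algebraMap_iff (FaithfulSMul.algebraMap_injective ℂ (Module.End ℂ V))).1 h1
  · have h1 := congrArg (LinearMap.trace ℂ V) (hz.symm.trans ha)
    rw [map_sum, map_smul, LinearMap.trace_id, smul_eq_mul, ← char_one] at h1
    rw [← h1, Finset.sum_congr rfl (g := fun _ ↦ V.character g), Finset.sum_const, nsmul_eq_mul,
      Nat.card_eq_fintype_card, Fintype.card_subtype]
    intro x hx
    rw [Finset.mem_filter_univ] at hx
    obtain ⟨c, rfl⟩ := isConj_iff.1 hx
    exact V.char_conj g c

/-- A character sums over a subgroup to a multiple of the order of the subgroup. -/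
theorem exists_sum_subgroup_character_eq (H : Subgroup G) [Fintype H] :
    ∃ n : ℕ, ∑ h : H, V.character h = Nat.card H * n := by
  have hH : (Nat.card H : ℂ) ≠ 0 := by exact_mod_cast Nat.card_pos.ne'
  have := invertibleOfNonzero hH
  let U : FDRep ℂ H := FDRep.of (V.ρ.comp H.subtype)
  have h := average_char_eq_finrank_invariants U
  refine ⟨finrank ℂ (Representation.invariants U.ρ), ?_⟩
  rw [← h, mul_inv_cancel_left₀ hH]
  rfl

end FDRep

section ConjClass

variable {G : Type*} [Group G]

/-- The conjugation action of a subgroup on a conjugacy class. -/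
@[reducible] def conjClassMulAction (H : Subgroup G) (y : G) : MulAction H {x // IsConj y x} where
  smul h x := ⟨h * x * (h : G)⁻¹, x.2.trans (isConj_iff.2 ⟨h, rfl⟩)⟩
  one_smul x := Subtype.ext (by change ((1 : H) : G) * x * ((1 : H) : G)⁻¹ = x; simp)
  mul_smul a b x := Subtype.ext (by
    change ((a * b : H) : G) * x * ((a * b : H) : G)⁻¹ = a * (b * x * (b : G)⁻¹) * (a : G)⁻¹
    simp [mul_assoc])

theorem mem_fixedPoints_conjClass_iff (H : Subgroup G) (y : G) (x : {x // IsConj y x}) :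
    let _ := conjClassMulAction H y
    x ∈ MulAction.fixedPoints H {x // IsConj y x} ↔ ∀ h ∈ H, h * (x : G) = x * h := by
  intro _
  rw [MulAction.mem_fixedPoints]
  constructor
  · intro hx h hh
    exact mul_inv_eq_iff_eq_mul.1 (congrArg Subtype.val (hx ⟨h, hh⟩))
  · intro hx h
    exact Subtype.ext (mul_inv_eq_iff_eq_mul.2 (hx h h.2))

/-- A `p`-subgroup centralizes an element of every conjugacy class of size prime to `p`. -/
theorem exists_isConj_commute_of_isPGroup [Finite G] {p : ℕ} [Fact p.Prime] {H : Subgroup G}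
    (hH : IsPGroup p H) (y : G) (hy : ¬ p ∣ Nat.card {x // IsConj y x}) :
    ∃ x, IsConj y x ∧ ∀ h ∈ H, h * x = x * h := by
  let _ := conjClassMulAction H y
  obtain ⟨x, hx⟩ := hH.nonempty_fixed_point_of_prime_not_dvd_card {x // IsConj y x} hy
  exact ⟨x, x.2, (mem_fixedPoints_conjClass_iff H y x).1 hx⟩

/-- The size of a conjugacy class of `p`-elements is congruent modulo `p` to the size of its
intersection with an abelian Sylow `p`-subgroup. -/
theorem card_isConj_modEq_card_isConj_sylow [Finite G] {p : ℕ} [Fact p.Prime] (Q : Sylow p G)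
    (hQ : ∀ a ∈ Q, ∀ b ∈ Q, a * b = b * a) {y : G} {k : ℕ} (hy : y ^ p ^ k = 1) :
    Nat.card {x // IsConj y x} ≡ Nat.card {q : Q // IsConj y q} [MOD p] := by
  let _ := conjClassMulAction (Q : Subgroup G) y
  refine (Q.isPGroup'.card_modEq_card_fixedPoints {x // IsConj y x}).trans ?_
  rw [Nat.card_congr (α := MulAction.fixedPoints Q {x // IsConj y x})
    (β := {q : Q // IsConj y q}) ?_]
  have hmem (x : {x // IsConj y x}) (hx : x ∈ MulAction.fixedPoints Q {x // IsConj y x}) :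
      (x : G) ∈ Q := by
    have hx' := (mem_fixedPoints_conjClass_iff (Q : Subgroup G) y x).1 hx
    have hp : IsPGroup p (Subgroup.zpowers (x : G)) := by
      obtain ⟨c, hc⟩ := isConj_iff.1 x.2
      refine IsPGroup.of_card_dvd_pow (n := k) ?_
      rw [Nat.card_zpowers, orderOf_dvd_iff_pow_eq_one, ← hc, conj_pow, hy]
      simp
    have hnorm : (x : G) ∈ Subgroup.normalizer (Q : Subgroup G) := by
      rw [Subgroup.mem_normalizer_iff]
      intro h
      constructor
      · intro hh
        rwa [← hx' h hh, mul_inv_cancel_right]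
      · intro hh
        have := hx' _ hh
        rw [inv_mul_cancel_right] at this
        rwa [mul_left_cancel this]
    have : (x : G) ∈ Subgroup.zpowers (x : G) ⊓ Subgroup.normalizer (Q : Subgroup G) :=
      ⟨Subgroup.mem_zpowers _, hnorm⟩
    exact ((hp.inf_normalizer_sylow Q).le this).2
  exact
    { toFun := fun x ↦ ⟨⟨x.1, hmem x.1 x.2⟩, x.1.2⟩
      invFun := fun q ↦ ⟨⟨q.1, q.2⟩, (mem_fixedPoints_conjClass_iff (Q : Subgroup G) y _).2
        fun h hh ↦ hQ h hh _ q.1.2⟩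
      left_inv := fun x ↦ rfl
      right_inv := fun q ↦ rfl }

theorem not_isConj_of_coprime {a b : G} {m n : ℕ} (ha : a ^ m = 1) (hb : b ^ n = 1)
    (hmn : m.Coprime n) (ha1 : a ≠ 1) : ¬ IsConj a b := by
  intro h
  obtain ⟨c, rfl⟩ := isConj_iff.1 h
  rw [conj_pow] at hb
  have hb' : a ^ n = 1 := by simpa using hb
  have := pow_gcd_eq_one.2 ⟨ha, hb'⟩
  rw [hmn.gcd_eq_one, pow_one] at this
  exact ha1 this

/-- The nontrivial conjugacy classes contribute `∑ g, c g ^ 2 - c 1 ^ 2` to the sum of squares of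
a class function `c`. -/
theorem sum_card_isConj_mul_sq_le [Fintype G] (c : G → ℤ)
    (hconj : ∀ g h, IsConj g h → c g = c h) (S : Finset G) (h1 : 1 ∉ S)
    (hS : ∀ g ∈ S, ∀ h ∈ S, g ≠ h → ¬ IsConj g h) :
    ∑ g ∈ S, (Nat.card {x // IsConj g x} : ℤ) * c g ^ 2 ≤ ∑ g, c g ^ 2 - c 1 ^ 2 := by
  classical
  have hcls (g : G) : (Nat.card {x // IsConj g x} : ℤ) * c g ^ 2 =
      ∑ x with IsConj g x, c x ^ 2 := by
    rw [Finset.sum_congr rfl (g := fun _ ↦ c g ^ 2), Finset.sum_const, nsmul_eq_mul,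
      Nat.card_eq_fintype_card, Fintype.card_subtype]
    intro x hx
    rw [hconj g x ((Finset.mem_filter_univ x).1 hx)]
  have hdisj : (S : Set G).PairwiseDisjoint fun g ↦ Finset.univ.filter (IsConj g) := by
    intro g hg h hh hgh
    refine Finset.disjoint_left.2 fun x hx hx' ↦ hS g hg h hh hgh ?_
    exact ((Finset.mem_filter_univ x).1 hx).trans ((Finset.mem_filter_univ x).1 hx').symm
  rw [Finset.sum_congr rfl fun g _ ↦ hcls g, ← Finset.sum_biUnion hdisj,
    ← Finset.sum_erase_add _ _ (Finset.mem_univ (1 : G)), add_sub_cancel_right]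
  refine Finset.sum_le_sum_of_subset_of_nonneg ?_ fun g _ _ ↦ sq_nonneg _
  intro x hx
  obtain ⟨g, hg, hgx⟩ := Finset.mem_biUnion.1 hx
  refine Finset.mem_erase.2 ⟨?_, Finset.mem_univ x⟩
  rintro rfl
  exact h1 (isConj_one_right.1 ((Finset.mem_filter_univ _).1 hgx).symm ▸ hg)

end ConjClass

section IntegerClassFunction

variable {G : Type*} [Group G] {c : G → ℤ}

theorem exists_mem_ne_zero_of_not_card_dvd [Fintype G]
    (hres : ∀ H : Subgroup G, ∃ n : ℤ, ∑ᶠ h : H, c h = Nat.card H * n)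
    (H : Subgroup G) (hH : ¬ (Nat.card H : ℤ) ∣ c 1) :
    ∃ z ∈ H, z ≠ 1 ∧ c z ≠ 0 := by
  by_contra! h
  obtain ⟨n, hn⟩ := hres H
  rw [finsum_eq_single _ (1 : H) fun x hx ↦ h x x.2 (by simpa using hx)] at hn
  exact hH ⟨n, hn⟩

theorem abs_le_mul_of_central {k a b d : ℤ} (hk : 0 < k) (hd : 0 < d) (h : k * a = d * b)
    (ha : a ≠ 0) : |a| ≤ a * b := by
  have hpos : 0 < a * b := by
    have : 0 < d * (a * b) := by
      have e : d * (a * b) = k * a ^ 2 := by linear_combination -a * h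
      rw [e]
      positivity
    exact pos_of_mul_pos_right this hd.le
  have hb : b ≠ 0 := by
    rintro rfl
    simp at hpos
  rw [← abs_of_pos hpos, abs_mul]
  exact le_mul_of_one_le_right (abs_nonneg a) (Int.one_le_abs hb)

/-- A group of order `7200` has no integer class function `c` of degree `80` that satisfies the
usual constraints on an irreducible character, with `w` its central character. -/
theorem not_integer_character_of_card_eq_7200 [Fintype G] (hcard : Nat.card G = 7200)
    (h1 : c 1 = 80) (hsum : ∑ g, c g ^ 2 = 7200) (hconj : ∀ g h, IsConj g h → c g = c h)
    {w : G → ℤ} (hw : ∀ g, (Nat.card {x // IsConj g x} : ℤ) * c g = 80 * w g)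
    (hpow : ∀ p : ℕ, p.Prime → ∀ g k, c (g ^ p ^ k) ≡ c g [ZMOD p])
    (hres : ∀ H : Subgroup G, ∃ n : ℤ, ∑ᶠ h : H, c h = Nat.card H * n) : False := by
  classical
  have hbound (l : List G) (hl1 : ∀ g ∈ l, g ≠ 1) (hl : l.Pairwise fun g h ↦ ¬ IsConj g h) :
      (l.map fun g ↦ c g * w g).sum ≤ 10 := by
    have hnd : l.Nodup := hl.imp fun hgh e ↦ hgh (by rw [e])
    have hsymm : Std.Symm fun g h : G ↦ ¬ IsConj g h := ⟨fun g h hgh e ↦ hgh e.symm⟩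
    have hS := sum_card_isConj_mul_sq_le c hconj l.toFinset
      (fun h ↦ hl1 1 (List.mem_toFinset.1 h) rfl)
      (fun g hg h hh ↦ hl.forall (List.mem_toFinset.1 hg) (List.mem_toFinset.1 hh))
    rw [hsum, h1, Finset.sum_congr rfl (g := fun g ↦ 80 * (c g * w g))
      (fun g _ ↦ by linear_combination c g * hw g), ← Finset.mul_sum,
      List.sum_toFinset _ hnd] at hS
    linarith
  have hpos (g : G) (hg : c g ≠ 0) : |c g| ≤ c g * w g := by
    have : Nonempty {x // IsConj g x} := ⟨g, IsConj.refl g⟩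
    exact abs_le_mul_of_central (mod_cast Nat.card_pos) (by simp) (hw g) hg
  have horder (p : ℕ) (hp : p.Prime) {k : ℕ} {g : G} (hg : g ^ p ^ k = 1) :
      c g ≡ 80 [ZMOD p] := by
    rw [← h1, ← hg]
    exact (hpow p hp g k).symm
  have p2 : Fact (Nat.Prime 2) := ⟨Nat.prime_two⟩
  have p3 : Fact (Nat.Prime 3) := ⟨Nat.prime_three⟩
  have p5 : Fact (Nat.Prime 5) := ⟨Nat.prime_five⟩
  obtain ⟨x, hx⟩ := exists_prime_orderOf_dvd_card' (G := G) 3 (by rw [hcard]; norm_num)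
  have hx1 : x ≠ 1 := by
    rintro rfl
    simp at hx
  have hx3 : x ^ 3 ^ 1 = 1 := by rw [pow_one, ← hx, pow_orderOf_eq_one]
  have hcx := horder 3 Nat.prime_three hx3
  have hcx0 : c x ≠ 0 := by
    intro h
    rw [h] at hcx
    norm_num [Int.ModEq] at hcx
  obtain ⟨R, hR⟩ := Sylow.exists_subgroup_card_pow_prime (G := G) 2 (n := 5)
    (by rw [hcard]; norm_num)
  obtain ⟨z, hzR, hz1, hcz0⟩ := exists_mem_ne_zero_of_not_card_dvd hres R
    (by rw [hR, h1]; norm_num)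
  have hz : z ^ 2 ^ 5 = 1 := by
    rw [← hR, ← orderOf_dvd_iff_pow_eq_one]
    exact R.orderOf_dvd_natCard hzR
  have hcz := horder 2 Nat.prime_two hz
  have hczw : 2 ≤ c z * w z := by
    refine le_trans ?_ (hpos z hcz0)
    have : (2 : ℤ) ∣ c z := Int.modEq_zero_iff_dvd.1 (hcz.trans (by decide))
    exact Int.le_of_dvd (abs_pos.2 hcz0) ((dvd_abs _ _).2 this)
  obtain ⟨Q⟩ := (inferInstance : Nonempty (Sylow 5 G))
  have hQ : Nat.card Q = 5 ^ 2 := by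
    rw [Q.card_eq_multiplicity, hcard]
    congr 1
    have h : 7200 = 5 ^ 2 * 288 := by norm_num
    rw [h, Nat.factorization_mul (by norm_num) (by norm_num), Nat.prime_five.factorization_pow]
    simp [Nat.factorization_eq_zero_of_not_dvd]
  have hQcomm : ∀ a ∈ Q, ∀ b ∈ Q, a * b = b * a := by
    have := IsPGroup.isMulCommutative_of_card_eq_prime_sq hQ
    intro a ha b hb
    exact congrArg Subtype.val (this.is_comm.comm (⟨a, ha⟩ : Q) ⟨b, hb⟩)
  have hQpow {q : G} (hq : q ∈ Q) : q ^ 5 ^ 2 = 1 := by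
    rw [← hQ, ← orderOf_dvd_iff_pow_eq_one]
    exact (Q : Subgroup G).orderOf_dvd_natCard hq
  have hQdvd {q : G} (hq : q ^ 5 ^ 2 = 1) : (5 : ℤ) ∣ c q :=
    Int.modEq_zero_iff_dvd.1 ((horder 5 Nat.prime_five hq).trans (by decide))
  have hcop (p q k l : ℕ) (hp : p.Prime) (hq : q.Prime) (hpq : p ≠ q) {a b : G}
      (ha : a ^ p ^ k = 1) (hb : b ^ q ^ l = 1) (ha1 : a ≠ 1) : ¬ IsConj a b :=
    not_isConj_of_coprime ha hb (((Nat.coprime_primes hp hq).2 hpq).pow k l) ha1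
  obtain ⟨y, hyQ, hy1, hcy0⟩ := exists_mem_ne_zero_of_not_card_dvd hres (Q : Subgroup G)
    (by rw [hQ, h1]; norm_num)
  have hy := hQpow hyQ
  have hyx := hcop 5 3 _ _ Nat.prime_five Nat.prime_three (by simp) hy hx3 hy1
  have hyz := hcop 5 2 _ _ Nat.prime_five Nat.prime_two (by simp) hy hz hy1
  have hzx := hcop 2 3 _ _ Nat.prime_two Nat.prime_three (by simp) hz hx3 hz1
  have hcxw : 1 ≤ c x * w x := (Int.one_le_abs hcx0).trans (hpos x hcx0)
  have hywle : c y * w y ≤ 7 := by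
    have := hbound [y, z, x] (by simp [hx1, hy1, hz1]) (by simp [-isConj_iff, hyx, hyz, hzx])
    simp at this
    linarith
  obtain ⟨a, ha⟩ := hQdvd hy
  have haw : a = 1 ∧ w y = 1 ∨ a = -1 ∧ w y = -1 := by
    have := hpos y hcy0
    have h0 := abs_pos.2 hcy0
    rw [ha] at this hywle h0
    exact Int.mul_eq_one_iff_eq_one_or_neg_one.1 (by linarith)
  have hk : Nat.card {g // IsConj y g} = 16 := by
    have := hw y
    rw [ha] at this
    rcases haw with ⟨h, h'⟩ | ⟨h, h'⟩ <;> rw [h, h'] at this <;> lia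
  have hQzero {q : G} (hq : q ∈ Q) (hq1 : q ≠ 1) (hyq : ¬ IsConj y q) : c q = 0 := by
    by_contra hcq0
    have h5 (g : G) (hg : g ∈ Q) (hg0 : c g ≠ 0) : 5 ≤ c g * w g :=
      (Int.le_of_dvd (abs_pos.2 hg0) ((dvd_abs _ _).2 (hQdvd (hQpow hg)))).trans (hpos g hg0)
    have hqx := hcop 5 3 _ _ Nat.prime_five Nat.prime_three (by simp) (hQpow hq) hx3 hq1
    have := hbound [y, q, x] (by simp [hx1, hy1, hq1]) (by simp [-isConj_iff, hyx, hyq, hqx])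
    simp at this
    linarith [h5 y hyQ hcy0, h5 q hq hcq0]
  have hcy : c y = -5 := by
    obtain ⟨n, hn⟩ := hres (Q : Subgroup G)
    have hsumQ : ∑ᶠ q : (Q : Subgroup G), c q = 80 + Nat.card {q : Q // IsConj y q} * c y := by
      have hval (q : (Q : Subgroup G)) :
          c q = (if q = 1 then 80 else 0) + if IsConj y q then c y else 0 := by
        by_cases hq : q = 1
        · subst hq
          simp [-isConj_iff, h1, hy1]
        · by_cases hyq : IsConj y q
          · simp [-isConj_iff, hq, hyq, hconj y q hyq]
          · simp [-isConj_iff, hq, hyq, hQzero q.2 (by simpa using hq) hyq]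
      rw [finsum_eq_sum_of_fintype, Finset.sum_congr rfl fun q _ ↦ hval q,
        Finset.sum_add_distrib, Finset.sum_ite_eq', ← Finset.sum_filter, Finset.sum_const,
        nsmul_eq_mul, Nat.card_eq_fintype_card, Fintype.card_subtype]
      simp only [Finset.mem_univ, if_true]
      congr!
    have hm := card_isConj_modEq_card_isConj_sylow Q hQcomm hy
    rw [hk] at hm
    rw [hsumQ, hQ, ha] at hn
    rcases haw with ⟨h, -⟩ | ⟨h, -⟩
    · exfalso
      rw [h] at hn
      unfold Nat.ModEq at hm
      push_cast at hn
      lia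
    · rw [ha, h]
      norm_num
  have hxgroup : IsPGroup 3 (Subgroup.zpowers x) :=
    IsPGroup.of_card (n := 1) (by rw [Nat.card_zpowers, hx, pow_one])
  obtain ⟨u, hyu, hxu⟩ := exists_isConj_commute_of_isPGroup hxgroup y (by rw [hk]; norm_num)
  have hcomm : Commute x u := hxu x (Subgroup.mem_zpowers x)
  have hu : u ^ 5 ^ 2 = 1 := by
    obtain ⟨g, rfl⟩ := isConj_iff.1 hyu
    rw [conj_pow, hy, mul_one, mul_inv_cancel]
  have hu1 : u ≠ 1 := by
    rintro rfl
    exact hy1 (isConj_one_left.1 hyu)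
  have hcu : c u = -5 := by rw [← hconj y u hyu, hcy]
  have hcxu3 : c (x * u) ≡ c u [ZMOD 3] := by
    have h := (hpow 3 Nat.prime_three (x * u) 1).symm
    rw [hcomm.mul_pow, hx3, one_mul] at h
    exact h.trans (hpow 3 Nat.prime_three u 1)
  have hcxu5 : c (x * u) ≡ c x [ZMOD 5] := by
    have h := (hpow 5 Nat.prime_five (x * u) 2).symm
    rw [hcomm.mul_pow, hu, mul_one] at h
    exact h.trans (hpow 5 Nat.prime_five x 2)
  have hxu0 : c (x * u) ≠ 0 := by
    intro h
    rw [h, hcu] at hcxu3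
    norm_num [Int.ModEq] at hcxu3
  have hxu : (x * u) ^ 75 = 1 := by
    rw [hcomm.mul_pow, pow_mul x 3 25, pow_mul' u 3 25]
    norm_num at hx3 hu
    simp [hx3, hu]
  have hxu1 : x * u ≠ 1 := by
    intro h
    rw [eq_inv_of_mul_eq_one_right h, inv_pow] at hu
    refine not_isConj_of_coprime hx3 (inv_eq_one.1 hu) (by norm_num) hx1 (IsConj.refl x)
  have hux := hcop 5 3 _ _ Nat.prime_five Nat.prime_three (by simp) hu hx3 hu1
  have huz := hcop 5 2 _ _ Nat.prime_five Nat.prime_two (by simp) hu hz hu1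
  have hxuz : ¬ IsConj z (x * u) := not_isConj_of_coprime hz hxu (by norm_num) hz1
  have hxux : ¬ IsConj x (x * u) := by
    intro h
    obtain ⟨g, hg⟩ := isConj_iff.1 h
    have h3 : (x * u) ^ 3 ^ 1 = 1 := by rw [← hg, conj_pow, hx3, mul_one, mul_inv_cancel]
    rw [hcomm.mul_pow, hx3, one_mul] at h3
    exact not_isConj_of_coprime h3 hu (by norm_num) hu1 (IsConj.refl u)
  have hxuu : ¬ IsConj u (x * u) := by
    intro h
    obtain ⟨g, hg⟩ := isConj_iff.1 h
    have h5 : (x * u) ^ 5 ^ 2 = 1 := by rw [← hg, conj_pow, hu, mul_one, mul_inv_cancel]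
    rw [hcomm.mul_pow, hu, mul_one] at h5
    exact not_isConj_of_coprime hx3 h5 (by norm_num) hx1 (IsConj.refl x)
  have h4 := hbound [u, z, x, x * u] (by simp [hx1, hu1, hz1, hxu1])
    (by simp [-isConj_iff, huz, hux, hzx, hxuz, hxux, hxuu])
  have hu5 := hpos u (by simp [hcu])
  have hxa := hpos x hcx0
  have hxua := hpos _ hxu0
  simp only [List.map_cons, List.map_nil, List.sum_cons, List.sum_nil] at h4
  rw [hcu] at hu5 hcxu3
  unfold Int.ModEq at hcx hcxu3 hcxu5
  norm_num at hu5 hcx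
  rw [hcu] at h4
  have h3 : |c x| + |c (x * u)| ≤ 3 := by linarith
  generalize c (x * u) = s at *
  generalize c x = t at *
  have ht := abs_le.1 (show |t| ≤ 3 by linarith [abs_nonneg s])
  have hs := abs_le.1 (show |s| ≤ 3 by linarith [abs_nonneg t])
  lia

end IntegerClassFunction

/-- There is no finite group of order 7200 with an irreducible complex character
of degree 80. -/
theorem no_group_order_7200_degree_80 (G : Type) [Group G] [Finite G]
    (hcard : Nat.card G = 7200)
    (χ : G → ℂ) (hχ : IsIrrChar G χ) (hdeg : χ 1 = (80 : ℂ)) :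
    False := by
  classical
  have := Fintype.ofFinite G
  obtain ⟨V, hV, rfl⟩ := hχ
  have hrank : finrank ℂ V = 80 := by
    rw [FDRep.char_one] at hdeg
    exact_mod_cast hdeg
  obtain ⟨c, hc⟩ := V.exists_int_character (by rw [hcard, hrank]; norm_num)
  have h1 : c 1 = 80 := by
    rw [hc] at hdeg
    exact_mod_cast hdeg
  have hw (g : G) : ∃ w : ℤ, (Nat.card {x // IsConj g x} : ℤ) * c g = 80 * w := by
    obtain ⟨a, ha, h⟩ := V.exists_isIntegral_centralCharacter g
    rw [hdeg, hc] at h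
    obtain ⟨w, rfl⟩ := exists_int_of_isIntegral_of_eq_ratCast ha
      (q := (Nat.card {x // IsConj g x} * c g : ℚ) / 80) (by
        push_cast
        rw [h, mul_div_cancel_right₀ _ (by norm_num)])
    refine ⟨w, ?_⟩
    rw [mul_comm 80]
    exact_mod_cast h
  choose w hw using hw
  refine not_integer_character_of_card_eq_7200 hcard h1 ?_ ?_ hw
    (fun p hp g k ↦ V.int_character_pow_prime_pow_modEq hc hp g k) ?_
  · have h := (FDRep.simple_iff_char_is_norm_one V).1 hV
    simp only [FDRep.character_inv_eq_conj, hcard] at h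
    simp only [hc, map_intCast, ← pow_two] at h
    exact_mod_cast h
  · intro g h hgh
    obtain ⟨x, rfl⟩ := isConj_iff.1 hgh
    have := V.char_conj g x
    rw [hc, hc] at this
    exact_mod_cast this.symm
  · intro H
    obtain ⟨n, hn⟩ := V.exists_sum_subgroup_character_eq H
    refine ⟨n, ?_⟩
    simp only [hc] at hn
    rw [finsum_eq_sum_of_fintype]
    exact_mod_cast hn
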